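/- arXiv:2206.01454 — 2 statements merged into one kernel-verified Lean document; each statement's English description precedes it below -/
import Mathlib

section
/- (Active minimax lower bound, large covariate noise, small response noise; Proposition 5.) With 𝒵 = [0,1]^{d_Z} and 𝒳 = ℝ^{d_X}, for every active estimator f̂_{x_0} (any sequential procedure in which each Z_i is a measurable, possibly randomized, function of the previous observations {(Z_j, X_j, Y_j)}_{j<i}, and the final estimate is measurable in the full dataset), the supremum over all g, f, P_Z, ε_X, ε_Y satisfying the assumptions of P[ |f̂_{x_0} − f(x_0)| ≥ C (σ_X^{d_X}/n)^{s_f/d_X} ] is at least 1/(2e), where C = L_f d_X^{−s_f/2} / (2 ‖K_{d_X}‖_{C^{s_f}}) depends only on L_f, s_f, and d_X. The supremum is over g in the global Hölder ball C^{s_g}(𝒵; 𝒳; L_g) with g(z_0) = x_0 for some z_0 around which P_Z has local dimension d_Z, f in the global Hölder ball C^{s_f}(𝒳; ℝ; L_f), distributions P_Z, sub-Gaussian ε_X with local dimension d_X around 0, and sub-Gaussian ε_Y. -/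
open MeasureTheory Filter Metric

noncomputable section

/-- The local Hölder ball `C^s(Z, z₀; X; L)`: functions `g` with
`dist (g z) (g z₀) ≤ L * (dist z z₀)^s` for all `z`. -/
def LocHolderBall {Z X : Type*} [PseudoMetricSpace Z] [PseudoMetricSpace X]
    (s L : ℝ) (z0 : Z) (g : Z → X) : Prop :=
  ∀ z, dist (g z) (g z0) ≤ L * dist z z0 ^ s

/-- The global Hölder ball `C^s(Z; X; L)`. -/
def GlobHolderBall {Z X : Type*} [PseudoMetricSpace Z] [PseudoMetricSpace X]
    (s L : ℝ) (g : Z → X) : Prop :=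
  ∀ z z', dist (g z) (g z') ≤ L * dist z z' ^ s

/-- A measure `P` on a metric space has local dimension `d` around `x`:
`liminf_{r↓0} P(closedBall x r)/r^d > 0`. -/
def HasLocalDim {X : Type*} [PseudoMetricSpace X] [MeasurableSpace X]
    (P : Measure X) (x : X) (d : ℝ) : Prop :=
  0 < liminf (fun r : ℝ => (P (closedBall x r)).toReal / r ^ d) (nhdsWithin 0 (Set.Ioi 0))

/-- A random variable `V` on `(Ω, μ)` has local dimension `d` around `x`. -/
def RVHasLocalDim {Ω X : Type*} [MeasurableSpace Ω] [PseudoMetricSpace X]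
    (μ : Measure Ω) (V : Ω → X) (x : X) (d : ℝ) : Prop :=
  0 < liminf (fun r : ℝ => (μ {ω | dist (V ω) x ≤ r}).toReal / r ^ d)
      (nhdsWithin 0 (Set.Ioi 0))

/-- A probability distribution on `ℝ^d` is sub-Gaussian:
`E[exp⟨x, t⟩] ≤ exp(‖t‖₂²/2)` for all `t`. -/
def SubGaussianVec {d : ℕ} (P : Measure (Fin d → ℝ)) : Prop :=
  ∀ t : Fin d → ℝ, ∫ x, Real.exp (∑ j, x j * t j) ∂P ≤ Real.exp ((∑ j, t j ^ 2) / 2)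

/-- A probability distribution on `ℝ` is sub-Gaussian. -/
def SubGaussianReal (P : Measure ℝ) : Prop :=
  ∀ t : ℝ, ∫ x, Real.exp (x * t) ∂P ≤ Real.exp (t ^ 2 / 2)

/-- `v` is a possible value of the `k`-nearest-neighbor regressor of the data
`(X i, Y i)` at the point `x0`: there is an enumeration of the data ordered by
increasing distance of `X i` to `x0` (ties broken arbitrarily), and `v` is the
average of the responses `Y i` over the first `k` data points. -/
def IsKNNValue {ι : Type*} [Fintype ι] {dX : ℕ} (k : ℕ) (x0 : Fin dX → ℝ)
    (X : ι → Fin dX → ℝ) (Y : ι → ℝ) (v : ℝ) : Prop :=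
  ∃ e : ι ≃ Fin (Fintype.card ι),
    (∀ i j : ι, e i ≤ e j → dist (X i) x0 ≤ dist (X j) x0) ∧
    v = (k : ℝ)⁻¹ * ∑ i : ι, if ((e i : ℕ) < k) then Y i else 0

/-- The cube `[0,1]^m` with the sup metric. -/
abbrev Cube (m : ℕ) := Fin m → Set.Icc (0:ℝ) 1

/-- The standard `d`-dimensional bump function
`K_d(x) = exp(1 - 1/(1 - ‖x‖₂²)) 1{‖x‖₂ < 1}`. -/
def bumpFn (d : ℕ) (x : Fin d → ℝ) : ℝ :=
  if (∑ j, x j ^ 2) < 1 then Real.exp (1 - 1 / (1 - ∑ j, x j ^ 2)) else 0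

/-- The Hölder seminorm `‖f‖_{C^s} = sup_{z ≠ z'} dist (f z) (f z') / dist z z' ^ s`. -/
def holderSeminorm {Z X : Type*} [PseudoMetricSpace Z] [PseudoMetricSpace X]
    (s : ℝ) (f : Z → X) : ℝ :=
  ⨆ p : Z × Z, if dist p.1 p.2 = 0 then 0 else dist (f p.1) (f p.2) / dist p.1 p.2 ^ s


section BumpFunction

lemma bumpFn_nonneg (d : ℕ) (x : Fin d → ℝ) : 0 ≤ bumpFn d x := by
  unfold bumpFn
  split_ifs <;> positivity

lemma bumpFn_le_one (d : ℕ) (x : Fin d → ℝ) : bumpFn d x ≤ 1 := by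
  unfold bumpFn
  split_ifs with h
  · rw [Real.exp_le_one_iff, sub_nonpos, le_div_iff₀ (by linarith)]
    have : 0 ≤ ∑ j, x j ^ 2 := Finset.sum_nonneg fun j _ => sq_nonneg _
    linarith
  · exact zero_le_one

lemma bumpFn_zero (d : ℕ) : bumpFn d 0 = 1 := by
  simp [bumpFn]

lemma bumpFn_eq_zero_of_one_le_abs {d : ℕ} {x : Fin d → ℝ} {j : Fin d} (h : 1 ≤ |x j|) :
    bumpFn d x = 0 := by
  have h1 : x j ^ 2 ≤ ∑ j, x j ^ 2 :=
    Finset.single_le_sum (f := fun j => x j ^ 2) (fun i _ => sq_nonneg _) (Finset.mem_univ j)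
  have h2 : 1 ≤ x j ^ 2 := (one_le_sq_iff_one_le_abs _).2 h
  rw [bumpFn, if_neg (by linarith)]

lemma bumpFn_eq_expNegInvGlue (d : ℕ) :
    bumpFn d = fun x => Real.exp 1 * expNegInvGlue (1 - ∑ j, x j ^ 2) := by
  funext x
  unfold bumpFn expNegInvGlue
  split_ifs with h1 h2 h2
  · linarith
  · rw [← Real.exp_add]
    ring_nf
  · simp
  · linarith

lemma exists_lipschitzWith_bumpFn (d : ℕ) : ∃ C, LipschitzWith C (bumpFn d) := by
  have hsupp : HasCompactSupport (bumpFn d) := by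
    refine HasCompactSupport.intro (isCompact_closedBall (0 : Fin d → ℝ) 1) fun x hx => ?_
    rw [mem_closedBall, dist_zero_right, pi_norm_le_iff_of_nonneg zero_le_one] at hx
    push Not at hx
    obtain ⟨j, hj⟩ := hx
    exact bumpFn_eq_zero_of_one_le_abs hj.le
  have hdiff : ContDiff ℝ 1 (bumpFn d) := by
    rw [bumpFn_eq_expNegInvGlue]
    refine contDiff_const.mul (expNegInvGlue.contDiff.comp ?_)
    fun_prop
  exact hdiff.lipschitzWith_of_hasCompactSupport hsupp one_ne_zero

lemma bddAbove_range_holder_quotient_bumpFn (d : ℕ) {s : ℝ} (hs : s ∈ Set.Ioc (0 : ℝ) 1) :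
    BddAbove (Set.range fun p : (Fin d → ℝ) × (Fin d → ℝ) =>
      if dist p.1 p.2 = 0 then 0 else
        dist (bumpFn d p.1) (bumpFn d p.2) / dist p.1 p.2 ^ s) := by
  obtain ⟨C, hC⟩ := exists_lipschitzWith_bumpFn d
  refine ⟨max C 1, ?_⟩
  rintro _ ⟨⟨x, y⟩, rfl⟩
  dsimp only
  split_ifs with h
  · exact zero_le_one.trans (le_max_right _ _)
  have hpos : 0 < dist x y := lt_of_le_of_ne dist_nonneg (Ne.symm h)
  rw [div_le_iff₀ (by positivity)]
  rcases le_total (dist x y) 1 with h1 | h1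
  · have h2 : dist x y ≤ dist x y ^ s := by
      simpa using Real.rpow_le_rpow_of_exponent_ge hpos h1 hs.2
    calc dist (bumpFn d x) (bumpFn d y) ≤ C * dist x y := hC.dist_le_mul x y
      _ ≤ max (C : ℝ) 1 * dist x y ^ s := by
        gcongr
        exact le_max_left _ _
  · have h2 : 1 ≤ dist x y ^ s := Real.one_le_rpow h1 hs.1.le
    have h3 : dist (bumpFn d x) (bumpFn d y) ≤ 1 := by
      rw [Real.dist_eq, abs_le]
      constructor <;> linarith [bumpFn_nonneg d x, bumpFn_nonneg d y, bumpFn_le_one d x,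
        bumpFn_le_one d y]
    calc dist (bumpFn d x) (bumpFn d y) ≤ 1 * 1 := by simpa using h3
      _ ≤ max (C : ℝ) 1 * dist x y ^ s := by
        gcongr
        exact le_max_right _ _

lemma globHolderBall_bumpFn (d : ℕ) {s : ℝ} (hs : s ∈ Set.Ioc (0 : ℝ) 1) :
    GlobHolderBall s (holderSeminorm s (bumpFn d)) (bumpFn d) := by
  intro x y
  by_cases h : dist x y = 0
  · rw [dist_eq_zero] at h
    subst h
    simp [Real.zero_rpow hs.1.ne']
  have hpos : 0 < dist x y := lt_of_le_of_ne dist_nonneg (Ne.symm h)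
  have := le_ciSup (bddAbove_range_holder_quotient_bumpFn d hs) (x, y)
  simp only [h, if_false] at this
  rwa [div_le_iff₀ (by positivity)] at this

/-- Rescaling the bump function to radius `h` and height `L / ‖K_d‖ * h ^ s` keeps its Hölder
seminorm at most `L`. -/
lemma globHolderBall_scaled_bumpFn (d : ℕ) {s L h : ℝ} (hs : s ∈ Set.Ioc (0 : ℝ) 1) (hL : 0 ≤ L)
    (hh : 0 < h) (x0 : Fin d → ℝ) :
    GlobHolderBall s L
      (fun x => L / holderSeminorm s (bumpFn d) * h ^ s * bumpFn d (h⁻¹ • (x - x0))) := by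
  intro x y
  set H := holderSeminorm s (bumpFn d)
  have hH : 0 ≤ H := Real.iSup_nonneg fun p => by split_ifs <;> positivity
  have hb := globHolderBall_bumpFn d hs (h⁻¹ • (x - x0)) (h⁻¹ • (y - x0))
  rw [dist_smul₀, dist_sub_right, Real.norm_of_nonneg (by positivity),
    Real.mul_rpow (by positivity) dist_nonneg, Real.inv_rpow hh.le] at hb
  have hhs : 0 < h ^ s := by positivity
  rw [Real.dist_eq, ← mul_sub, abs_mul, abs_of_nonneg (by positivity), ← Real.dist_eq]
  calc L / H * h ^ s * dist (bumpFn d (h⁻¹ • (x - x0))) (bumpFn d (h⁻¹ • (y - x0)))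
      ≤ L / H * h ^ s * (H * ((h ^ s)⁻¹ * dist x y ^ s)) := by gcongr
    _ = L * (H / H) * dist x y ^ s := by field_simp
    _ ≤ L * 1 * dist x y ^ s := by
      gcongr
      exact div_self_le_one H
    _ = L * dist x y ^ s := by rw [mul_one]

end BumpFunction

section LocalDimension

lemma hasLocalDim_of_forall_eq {X : Type*} [PseudoMetricSpace X] [MeasurableSpace X]
    {P : Measure X} {x : X} {d c : ℝ} (hc : 0 < c)
    (h : ∀ r, 0 < r → r < 1 → (P (closedBall x r)).toReal = c * r ^ d) : HasLocalDim P x d := by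
  have heq : (fun r : ℝ => (P (closedBall x r)).toReal / r ^ d)
      =ᶠ[nhdsWithin 0 (Set.Ioi 0)] fun _ => c := by
    filter_upwards [Ioo_mem_nhdsGT (zero_lt_one' ℝ)] with r hr
    rw [h r hr.1 hr.2, mul_div_cancel_right₀ _ (Real.rpow_pos_of_pos hr.1 d).ne']
  rw [HasLocalDim, liminf_congr heq]
  simpa using hc

lemma hasLocalDim_volume_cube (d : ℕ) :
    HasLocalDim (volume : Measure (Cube d)) 0 (d : ℝ) := by
  refine hasLocalDim_of_forall_eq one_pos fun r h0 h1 => ?_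
  have hball : (volume : Measure (Set.Icc (0 : ℝ) 1)) (closedBall 0 r) = ENNReal.ofReal r := by
    have himg : Subtype.val '' (closedBall (0 : Set.Icc (0 : ℝ) 1) r) = Set.Icc 0 r := by
      ext y
      simp only [Set.mem_image, mem_closedBall, Subtype.exists, Subtype.dist_eq, Real.dist_eq,
        Set.mem_Icc]
      constructor
      · rintro ⟨a, ha, hr, rfl⟩
        simp only [Set.Icc.coe_zero, sub_zero] at hr
        exact ⟨ha.1, (le_abs_self _).trans hr⟩
      · rintro ⟨ha, hb⟩
        exact ⟨y, ⟨ha, hb.trans h1.le⟩, by simpa [abs_of_nonneg ha] using hb, rfl⟩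
    rw [← volume_image_subtype_coe measurableSet_Icc, himg, Real.volume_Icc, sub_zero]
  rw [closedBall_pi _ h0.le, volume_pi, Measure.pi_pi]
  simp [hball, h0.le]

end LocalDimension

section NoiseDistribution

/-- A symmetric distribution on `[-1, 1]` which puts mass `1 - q` on `{-1, 1}` and has constant
density `q / 2` in between. -/
def signUniformMixture (q : ℝ) : Measure ℝ :=
  ENNReal.ofReal ((1 - q) / 2) • Measure.dirac 1 +
    ENNReal.ofReal ((1 - q) / 2) • Measure.dirac (-1) +
    ENNReal.ofReal (q / 2) • volume.restrict (Set.Icc (-1) 1)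

variable {q : ℝ}

lemma isProbabilityMeasure_signUniformMixture (h0 : 0 ≤ q) (h1 : q ≤ 1) :
    IsProbabilityMeasure (signUniformMixture q) := by
  constructor
  simp only [signUniformMixture, Measure.add_apply, Measure.smul_apply, measure_univ, smul_eq_mul,
    mul_one, Measure.restrict_apply_univ, Real.volume_Icc]
  rw [← ENNReal.ofReal_mul (by linarith), ← ENNReal.ofReal_add (by linarith) (by linarith),
    ← ENNReal.ofReal_add (by linarith) (by linarith)]
  norm_num

lemma signUniformMixture_ae_mem_Icc : ∀ᵐ x ∂signUniformMixture q, x ∈ Set.Icc (-1 : ℝ) 1 := by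
  rw [signUniformMixture, ae_add_measure_iff, ae_add_measure_iff]
  refine ⟨⟨Measure.ae_smul_measure ?_ _, Measure.ae_smul_measure ?_ _⟩,
    Measure.ae_smul_measure (ae_restrict_mem measurableSet_Icc) _⟩ <;>
  · refine (ae_dirac_iff (p := fun x : ℝ => x ∈ Set.Icc (-1 : ℝ) 1) measurableSet_Icc).2 ?_
    norm_num

lemma integral_id_signUniformMixture : ∫ x, x ∂signUniformMixture q = 0 := by
  have hd (a : ℝ) : Integrable (fun x : ℝ => x)
      (ENNReal.ofReal ((1 - q) / 2) • Measure.dirac a) :=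
    (integrable_dirac (by simp)).smul_measure ENNReal.ofReal_ne_top
  have hu : Integrable (fun x : ℝ => x) (volume.restrict (Set.Icc (-1) 1)) :=
    continuous_id'.integrableOn_Icc
  have hv : Integrable (fun x : ℝ => x)
      (ENNReal.ofReal (q / 2) • volume.restrict (Set.Icc (-1) 1)) :=
    hu.smul_measure ENNReal.ofReal_ne_top
  rw [signUniformMixture, integral_add_measure ((hd 1).add_measure (hd (-1))) hv,
    integral_add_measure (hd 1) (hd (-1))]
  simp only [integral_smul_measure, integral_dirac]
  rw [integral_Icc_eq_integral_Ioc, ← intervalIntegral.integral_of_le (by norm_num)]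
  simp

lemma signUniformMixture_closedBall (h0 : 0 ≤ q) {r : ℝ} (hr1 : r < 1) :
    signUniformMixture q (closedBall 0 r) = ENNReal.ofReal (q * r) := by
  have hsub : closedBall (0 : ℝ) r ∩ Set.Icc (-1) 1 = closedBall 0 r := by
    rw [Set.inter_eq_left, Real.closedBall_eq_Icc]
    exact Set.Icc_subset_Icc (by linarith) (by linarith)
  simp only [signUniformMixture, Measure.add_apply, Measure.smul_apply, smul_eq_mul]
  rw [Measure.dirac_apply' _ measurableSet_closedBall, Measure.dirac_apply' _
    measurableSet_closedBall, Measure.restrict_apply measurableSet_closedBall, hsub,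
    Real.volume_closedBall, Set.indicator_of_notMem (by simpa using hr1),
    Set.indicator_of_notMem (by simpa using hr1), ← ENNReal.ofReal_mul (by linarith)]
  simp only [mul_zero, zero_add]
  ring_nf

lemma le_signUniformMixture_one_le_abs (h1 : q ≤ 1) :
    ENNReal.ofReal (1 - q) ≤ signUniformMixture q {x | 1 ≤ |x|} := by
  have hm : MeasurableSet {x : ℝ | 1 ≤ |x|} := measurableSet_le measurable_const (by fun_prop)
  simp only [signUniformMixture, Measure.add_apply, Measure.smul_apply, smul_eq_mul]
  rw [Measure.dirac_apply' _ hm, Measure.dirac_apply' _ hm, Set.indicator_of_mem (by simp),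
    Set.indicator_of_mem (by simp)]
  refine le_trans ?_ le_self_add
  simp only [Pi.one_apply, mul_one]
  rw [← ENNReal.ofReal_add (by linarith) (by linarith)]
  ring_nf
  rfl

end NoiseDistribution

section ProductNoise

variable {ν : Measure ℝ} [IsProbabilityMeasure ν]

lemma subGaussianVec_pi (d : ℕ) (hν : ∀ᵐ x ∂ν, x ∈ Set.Icc (-1 : ℝ) 1) (hmean : ∫ x, x ∂ν = 0) :
    SubGaussianVec (Measure.pi fun _ : Fin d => ν) := by
  intro t
  have hmgf := ProbabilityTheory.hasSubgaussianMGF_of_mem_Icc_of_integral_eq_zero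
    (X := fun x : ℝ => x) (μ := ν) aemeasurable_id hν hmean
  simp_rw [Real.exp_sum]
  rw [integral_fintype_prod_eq_prod (f := fun j x => Real.exp (x * t j)), Finset.sum_div,
    Real.exp_sum]
  refine Finset.prod_le_prod (fun j _ => integral_nonneg fun _ => (Real.exp_pos _).le) fun j _ => ?_
  have := hmgf.mgf_le (t j)
  rw [ProbabilityTheory.mgf] at this
  simp_rw [mul_comm (t j)] at this
  refine this.trans_eq ?_
  norm_num

lemma integral_eval_pi (d : ℕ) (hmean : ∫ x, x ∂ν = 0) (j : Fin d) :
    ∫ x, x j ∂(Measure.pi fun _ : Fin d => ν) = 0 := by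
  have hpres := measurePreserving_eval (fun _ : Fin d => ν) j
  rw [← hmean]
  conv_rhs => rw [← hpres.map_eq]
  exact (integral_map hpres.aemeasurable aestronglyMeasurable_id).symm

lemma hasLocalDim_pi (d : ℕ) {q : ℝ} (hq : 0 < q)
    (h : ∀ r, 0 < r → r < 1 → ν (closedBall 0 r) = ENNReal.ofReal (q * r)) :
    HasLocalDim (Measure.pi fun _ : Fin d => ν) 0 (d : ℝ) := by
  refine hasLocalDim_of_forall_eq (pow_pos hq d) fun r h0 h1 => ?_
  rw [closedBall_pi _ h0.le, Measure.pi_pi]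
  simp only [Pi.zero_apply, h r h0 h1, Finset.prod_const, Finset.card_univ, Fintype.card_fin]
  rw [ENNReal.toReal_pow, ENNReal.toReal_ofReal (by positivity), mul_pow, Real.rpow_natCast]

end ProductNoise

/-- If one trial fails with probability at most `1 / (2n)`, then `n` independent trials all
succeed with probability at least `1 / 2`. -/
lemma half_le_prod_pi {U E : Type*} [MeasurableSpace U] [MeasurableSpace E] (PU : Measure U)
    [IsProbabilityMeasure PU] (P : Measure E) [IsProbabilityMeasure P] {n : ℕ} (hn : 0 < n)
    {S : Set E} (hS : ENNReal.ofReal (1 - 1 / (2 * n)) ≤ P S) :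
    ENNReal.ofReal (1 / 2) ≤
      (PU.prod (Measure.pi fun _ : Fin n => P)) {ω | ∀ i, ω.2 i ∈ S} := by
  have hset : {ω : U × (Fin n → E) | ∀ i, ω.2 i ∈ S}
      = Set.univ ×ˢ Set.univ.pi fun _ => S := by
    ext ω
    simp
  have hn1 : (1 : ℝ) ≤ n := by exact_mod_cast hn
  have hinv : 1 / (2 * n : ℝ) ≤ 1 / 2 := by
    apply one_div_le_one_div_of_le <;> linarith
  rw [hset, Measure.prod_prod, measure_univ, one_mul, Measure.pi_pi]
  simp only [Finset.prod_const, Finset.card_univ, Fintype.card_fin]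
  calc ENNReal.ofReal (1 / 2) ≤ ENNReal.ofReal ((1 - 1 / (2 * n)) ^ n) := by
        apply ENNReal.ofReal_le_ofReal
        have := one_add_mul_le_pow (a := -(1 / (2 * n : ℝ))) (by linarith) n
        rw [← sub_eq_add_neg] at this
        refine le_trans (le_of_eq ?_) this
        field_simp
        norm_num
    _ = ENNReal.ofReal (1 - 1 / (2 * n)) ^ n := ENNReal.ofReal_pow (by linarith) n
    _ ≤ P S ^ n := by gcongr

/-- **Proposition 5 (Active minimax lower bound, large covariate noise, small response
noise),** with the explicit constant `C = L_f d_X^{-s_f/2} / (2 ‖K_{d_X}‖_{C^{s_f}})`. -/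
theorem active_lower_bound_no_response_noise
    (sg sf Lg Lf : ℝ) (dX dZ : ℕ)
    (hsg : sg ∈ Set.Ioc (0:ℝ) 1) (hsf : sf ∈ Set.Ioc (0:ℝ) 1)
    (hLg : 0 < Lg) (hLf : 0 < Lf) (hdX : 0 < dX) (hdZ : 0 < dZ) :
      ∀ (n : ℕ), 0 < n →
      ∀ (σX σY : ℝ), 0 ≤ σX → 0 ≤ σY →
      ∀ x0 : Fin dX → ℝ,
      ∀ (U : Type) [MeasurableSpace U] (PU : Measure U) [IsProbabilityMeasure PU]
        (ζ : (i : Fin n) → (Fin (i : ℕ) → Cube dZ × (Fin dX → ℝ) × ℝ) → U → Cube dZ)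
        (est : (Fin n → Cube dZ × (Fin dX → ℝ) × ℝ) → U → ℝ),
        (∀ i : Fin n, Measurable
          (fun p : (Fin (i : ℕ) → Cube dZ × (Fin dX → ℝ) × ℝ) × U => ζ i p.1 p.2)) →
        Measurable (fun p : (Fin n → Cube dZ × (Fin dX → ℝ) × ℝ) × U => est p.1 p.2) →
      ∃ (g : Cube dZ → Fin dX → ℝ) (f : (Fin dX → ℝ) → ℝ)
        (PZ : Measure (Cube dZ)) (PeX : Measure (Fin dX → ℝ)) (PeY : Measure ℝ),
        IsProbabilityMeasure PZ ∧ IsProbabilityMeasure PeX ∧ IsProbabilityMeasure PeY ∧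
        GlobHolderBall sg Lg g ∧ GlobHolderBall sf Lf f ∧
        (∃ z0 : Cube dZ, g z0 = x0 ∧ HasLocalDim PZ z0 (dZ : ℝ)) ∧
        HasLocalDim PeX 0 (dX : ℝ) ∧
        SubGaussianVec PeX ∧ SubGaussianReal PeY ∧
        (∀ j, ∫ x, x j ∂PeX = 0) ∧ (∫ y, y ∂PeY = 0) ∧
        ∀ (Z : Fin n → U × (Fin n → (Fin dX → ℝ) × ℝ) → Cube dZ)
          (X : Fin n → U × (Fin n → (Fin dX → ℝ) × ℝ) → (Fin dX → ℝ))
          (Y : Fin n → U × (Fin n → (Fin dX → ℝ) × ℝ) → ℝ),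
          (∀ i ω, Z i ω = ζ i (fun j =>
              (Z ⟨(j : ℕ), j.2.trans i.2⟩ ω,
               X ⟨(j : ℕ), j.2.trans i.2⟩ ω,
               Y ⟨(j : ℕ), j.2.trans i.2⟩ ω)) ω.1) →
          (∀ i ω, X i ω = g (Z i ω) + σX • (ω.2 i).1) →
          (∀ i ω, Y i ω = f (X i ω) + σY * (ω.2 i).2) →
          1 / (2 * Real.exp 1) ≤
            ((PU.prod (Measure.pi fun _ : Fin n => PeX.prod PeY))
              {ω | Lf * (dX : ℝ) ^ (-sf / 2) / (2 * holderSeminorm sf (bumpFn dX)) * (σX ^ (dX : ℝ) / n) ^ (sf / (dX : ℝ)) ≤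
                |est (fun i => (Z i ω, X i ω, Y i ω)) ω.1 - f x0|}).toReal := by
  intro n hn σX σY hσX hσY x0 U _ PU _ ζ est hζ hest
  have hn1 : (1 : ℝ) ≤ n := by exact_mod_cast hn
  have hd1 : (1 : ℝ) ≤ dX := by exact_mod_cast hdX
  have hd0 : (0 : ℝ) < dX := by linarith
  set q : ℝ := 1 / (2 * n) with hq
  have hq0 : 0 < q := by positivity
  have hq1 : q ≤ 1 := by
    rw [hq, div_le_one (by positivity)]
    linarith
  have hν := isProbabilityMeasure_signUniformMixture hq0.le hq1
  set ν := signUniformMixture q with hνdef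
  set PeX : Measure (Fin dX → ℝ) := Measure.pi fun _ => ν with hPeX
  set PeY : Measure ℝ := Measure.dirac 0 with hPeY
  set H := holderSeminorm sf (bumpFn dX) with hH
  set τ : ℝ := Lf * (dX : ℝ) ^ (-sf / 2) / (2 * H) * (σX ^ (dX : ℝ) / n) ^ (sf / (dX : ℝ)) with hτ
  set μ := PU.prod (Measure.pi fun _ : Fin n => PeX.prod PeY) with hμ
  have he : 1 / (2 * Real.exp 1) ≤ 1 / 4 := by
    apply one_div_le_one_div_of_le (by norm_num)
    linarith [Real.add_one_le_exp 1]
  -- Everything but the response function is the same under both hypotheses.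
  suffices hf : ∃ f : (Fin dX → ℝ) → ℝ, GlobHolderBall sf Lf f ∧
      ∀ (Z : Fin n → U × (Fin n → (Fin dX → ℝ) × ℝ) → Cube dZ)
        (X : Fin n → U × (Fin n → (Fin dX → ℝ) × ℝ) → (Fin dX → ℝ))
        (Y : Fin n → U × (Fin n → (Fin dX → ℝ) × ℝ) → ℝ),
        (∀ i ω, Z i ω = ζ i (fun j =>
            (Z ⟨(j : ℕ), j.2.trans i.2⟩ ω,
             X ⟨(j : ℕ), j.2.trans i.2⟩ ω,
             Y ⟨(j : ℕ), j.2.trans i.2⟩ ω)) ω.1) →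
        (∀ i ω, X i ω = x0 + σX • (ω.2 i).1) →
        (∀ i ω, Y i ω = f (X i ω) + σY * (ω.2 i).2) →
        1 / (2 * Real.exp 1) ≤
          (μ {ω | τ ≤ |est (fun i => (Z i ω, X i ω, Y i ω)) ω.1 - f x0|}).toReal by
    obtain ⟨f, hfH, hf⟩ := hf
    refine ⟨fun _ => x0, f, volume, PeX, PeY, inferInstance, inferInstance, inferInstance, ?_, hfH,
      ⟨0, rfl, hasLocalDim_volume_cube dZ⟩,
      hasLocalDim_pi dX hq0 fun r _ => signUniformMixture_closedBall hq0.le,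
      subGaussianVec_pi dX signUniformMixture_ae_mem_Icc integral_id_signUniformMixture, ?_,
      integral_eval_pi dX integral_id_signUniformMixture, integral_dirac _ _, hf⟩
    · intro z z'
      rw [dist_self]
      positivity
    · intro t
      simp only [hPeY, integral_dirac, zero_mul, Real.exp_zero]
      exact Real.one_le_exp (by positivity)
  have hzero : GlobHolderBall sf Lf (fun _ : Fin dX → ℝ => (0 : ℝ)) := by
    intro z z'
    rw [dist_self]
    positivity
  rcases hσX.eq_or_lt with hσ | hσ
  · refine ⟨_, hzero, fun Z X Y _ _ _ => ?_⟩
    have hτ0 : τ = 0 := by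
      rw [hτ, ← hσ, Real.zero_rpow hd0.ne', zero_div,
        Real.zero_rpow (div_pos hsf.1 hd0).ne', mul_zero]
    simp only [hτ0, abs_nonneg, Set.ofPred_true, measure_univ, ENNReal.toReal_one]
    linarith
  set h : ℝ := (dX : ℝ) ^ (-1 / 2 : ℝ) * (σX ^ (dX : ℝ) / n) ^ (1 / (dX : ℝ)) with hh
  have hh0 : 0 < h := by positivity
  have hhσ : h ≤ σX := by
    have h1 : (dX : ℝ) ^ (-1 / 2 : ℝ) ≤ 1 := Real.rpow_le_one_of_one_le_of_nonpos hd1 (by norm_num)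
    have h2 : (σX ^ (dX : ℝ) / n) ^ (1 / (dX : ℝ)) ≤ σX := by
      calc (σX ^ (dX : ℝ) / n) ^ (1 / (dX : ℝ)) ≤ (σX ^ (dX : ℝ)) ^ (1 / (dX : ℝ)) := by
            gcongr
            exact div_le_self (by positivity) hn1
        _ = σX := by rw [← Real.rpow_mul hσX, mul_one_div_cancel hd0.ne', Real.rpow_one]
    calc h ≤ 1 * σX := mul_le_mul h1 h2 (by positivity) zero_le_one
      _ = σX := one_mul _
  set f₁ : (Fin dX → ℝ) → ℝ := fun x => Lf / H * h ^ sf * bumpFn dX (h⁻¹ • (x - x0)) with hf₁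
  have hf₁x0 : f₁ x0 = 2 * τ := by
    have hhs : h ^ sf = (dX : ℝ) ^ (-sf / 2) * (σX ^ (dX : ℝ) / n) ^ (sf / (dX : ℝ)) := by
      rw [hh, Real.mul_rpow (by positivity) (by positivity), ← Real.rpow_mul hd0.le,
        ← Real.rpow_mul (by positivity)]
      congr 2 <;> ring
    simp only [hf₁, sub_self, smul_zero, bumpFn_zero, hhs, hτ]
    field_simp
  by_contra! hcon
  obtain ⟨Z₀, X₀, Y₀, hZ₀, hX₀, hY₀, hlt₀⟩ := hcon _ hzero
  obtain ⟨Z₁, X₁, Y₁, hZ₁, hX₁, hY₁, hlt₁⟩ :=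
    hcon f₁ (globHolderBall_scaled_bumpFn dX hsf hLf.le hh0 x0)
  set S : Set ((Fin dX → ℝ) × ℝ) := {x : Fin dX → ℝ | 1 ≤ |x ⟨0, hdX⟩|} ×ˢ Set.univ with hS
  have hPS : ENNReal.ofReal (1 - 1 / (2 * n)) ≤ (PeX.prod PeY) S := by
    rw [hS, Measure.prod_prod, measure_univ, mul_one]
    refine (le_signUniformMixture_one_le_abs hq1).trans_eq ?_
    exact ((measurePreserving_eval (fun _ : Fin dX => ν) ⟨0, hdX⟩).measure_preimage
      (measurableSet_le measurable_const (by fun_prop)).nullMeasurableSet).symm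
  have hhalf := half_le_prod_pi PU (PeX.prod PeY) hn hPS
  have hsub : {ω : U × (Fin n → (Fin dX → ℝ) × ℝ) | ∀ i, ω.2 i ∈ S} ⊆
      {ω | τ ≤ |est (fun i => (Z₀ i ω, X₀ i ω, Y₀ i ω)) ω.1 - 0|} ∪
      {ω | τ ≤ |est (fun i => (Z₁ i ω, X₁ i ω, Y₁ i ω)) ω.1 - f₁ x0|} := by
    intro ω hω
    have hX : ∀ i, X₀ i ω = X₁ i ω := fun i => by rw [hX₀, hX₁]
    have hY : ∀ i, Y₀ i ω = Y₁ i ω := fun i => by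
      have hfar : f₁ (X₁ i ω) = 0 := by
        have hb : bumpFn dX (h⁻¹ • (X₁ i ω - x0)) = 0 := by
          apply bumpFn_eq_zero_of_one_le_abs (j := ⟨0, hdX⟩)
          have h1 : 1 ≤ |(ω.2 i).1 ⟨0, hdX⟩| := (hω i).1
          have h2 : 1 ≤ h⁻¹ * σX := by
            rwa [inv_mul_eq_div, one_le_div hh0]
          rw [hX₁, add_sub_cancel_left, smul_smul, Pi.smul_apply, smul_eq_mul, abs_mul,
            abs_of_pos (by positivity)]
          exact one_le_mul_of_one_le_of_one_le h2 h1
        simp only [hf₁, hb, mul_zero]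
      rw [hY₀, hY₁, hfar]
    have hZ : ∀ (k : ℕ) (hk : k < n), Z₀ ⟨k, hk⟩ ω = Z₁ ⟨k, hk⟩ ω := by
      intro k
      induction k using Nat.strong_induction_on with
      | _ k ih =>
        intro hk
        rw [hZ₀, hZ₁]
        congr 1
        funext j
        rw [ih j j.2, hX, hY]
    have hdata : (fun i => (Z₀ i ω, X₀ i ω, Y₀ i ω)) = fun i => (Z₁ i ω, X₁ i ω, Y₁ i ω) := by
      funext i
      rw [hX, hY, hZ i i.2]
    simp only [Set.mem_union, Set.mem_ofPred_eq, hdata, hf₁x0]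
    by_contra! hlt
    have h1 := (abs_lt.1 hlt.1).2
    have h2 := (abs_lt.1 hlt.2).1
    linarith
  have hle := hhalf.trans ((measure_mono hsub).trans (measure_union_le _ _))
  have hle' := ENNReal.toReal_mono (by finiteness) hle
  rw [ENNReal.toReal_ofReal (by norm_num), ENNReal.toReal_add (by finiteness) (by finiteness)]
    at hle'
  linarith

end
end

section
/- (Active minimax lower bound, small covariate noise, large response noise; Proposition 6.) With 𝒵 = [0,1]^{d_Z} and 𝒳 = ℝ^{d_X}, for every active estimator f̂_{x_0} (any sequential procedure in which each Z_i is a measurable, possibly randomized, function of the previous observations {(Z_j, X_j, Y_j)}_{j<i}, and the final estimate is measurable in the full dataset), the supremum over all g, f, P_Z, ε_X, ε_Y satisfying the assumptions of P[ |f̂_{x_0} − f(x_0)| ≥ σ_Y/(4√n) ] is at least 1/4. The supremum is over g in the global Hölder ball C^{s_g}(𝒵; 𝒳; L_g) with g(z_0) = x_0 for some z_0 around which P_Z has local dimension d_Z, f in the global Hölder ball C^{s_f}(𝒳; ℝ; L_f), distributions P_Z, sub-Gaussian ε_X with local dimension d_X around 0, and sub-Gaussian ε_Y. -/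
open MeasureTheory Filter Metric

noncomputable section

lemma prod_withDensity_comp_snd {α β : Type*} [MeasurableSpace α] [MeasurableSpace β]
    (μ : Measure α) (ν : Measure β) [IsProbabilityMeasure μ] [IsProbabilityMeasure ν]
    (ℓ : β → ENNReal) (hℓ : Measurable ℓ) [SigmaFinite (ν.withDensity ℓ)] :
    μ.prod (ν.withDensity ℓ) = (μ.prod ν).withDensity (fun p => ℓ p.2) := by
  refine Measure.prod_eq fun s t hs ht => ?_
  rw [withDensity_apply _ (hs.prod ht), withDensity_apply _ ht, ← Measure.prod_restrict,
    lintegral_prod _ (by fun_prop)]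
  simp [mul_comm]

lemma lintegral_pi_prod_eval {ι β : Type*} [Fintype ι] [MeasurableSpace β]
    (ν : ι → Measure β) [∀ i, IsProbabilityMeasure (ν i)]
    (F : ι → β → ENNReal) (hF : ∀ i, Measurable (F i)) :
    ∫⁻ e, ∏ i, F i (e i) ∂(Measure.pi ν) = ∏ i, ∫⁻ x, F i x ∂(ν i) := by
  rw [ProbabilityTheory.lintegral_prod_eq_prod_lintegral_of_indepFun Finset.univ
    (fun i (e : ι → β) => F i (e i))
    (ProbabilityTheory.iIndepFun_pi fun i => (hF i).aemeasurable) (fun i => by fun_prop)]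
  exact Finset.prod_congr rfl fun i _ =>
    (measurePreserving_eval ν i).lintegral_comp (hF i)

lemma pi_withDensity_prod {ι β : Type*} [Fintype ι] [MeasurableSpace β]
    (ν : Measure β) [IsProbabilityMeasure ν]
    (ℓ : β → ENNReal) (hℓ : Measurable ℓ) [SigmaFinite (ν.withDensity ℓ)] :
    Measure.pi (fun _ : ι => ν.withDensity ℓ)
      = (Measure.pi fun _ : ι => ν).withDensity (fun e => ∏ i, ℓ (e i)) := by
  refine Measure.pi_eq fun s hs => ?_
  have hind : ∀ e : ι → β, (Set.univ.pi s).indicator (fun e => ∏ i, ℓ (e i)) e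
      = ∏ i, (s i).indicator ℓ (e i) := by
    intro e
    classical
    by_cases he : e ∈ Set.univ.pi s
    · rw [Set.indicator_of_mem he]
      exact Finset.prod_congr rfl fun i _ =>
        (Set.indicator_of_mem (he i (Set.mem_univ i)) _).symm
    · rw [Set.indicator_of_notMem he]
      simp only [Set.mem_univ_pi, not_forall] at he
      obtain ⟨i, hi⟩ := he
      exact (Finset.prod_eq_zero (Finset.mem_univ i) (Set.indicator_of_notMem hi _)).symm
  rw [withDensity_apply _ (MeasurableSet.univ_pi hs), ← lintegral_indicator (.univ_pi hs)]
  simp_rw [hind]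
  rw [lintegral_pi_prod_eval _ _ fun i => hℓ.indicator (hs i)]
  refine Finset.prod_congr rfl fun i _ => ?_
  rw [withDensity_apply _ (hs i), lintegral_indicator (hs i)]

/-- The likelihood ratio of `N(h, 1)` with respect to `N(0, 1)`. -/
def gaussianShiftDensity (h y : ℝ) : ENNReal := ENNReal.ofReal (Real.exp (h * y - h ^ 2 / 2))

lemma measurable_gaussianShiftDensity (h : ℝ) : Measurable (gaussianShiftDensity h) := by
  unfold gaussianShiftDensity
  fun_prop

lemma gaussianReal_map_add_eq_withDensity (h : ℝ) :
    (ProbabilityTheory.gaussianReal 0 1).map (· + h)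
      = (ProbabilityTheory.gaussianReal 0 1).withDensity (gaussianShiftDensity h) := by
  rw [ProbabilityTheory.gaussianReal_map_add_const,
    ProbabilityTheory.gaussianReal_of_var_ne_zero _ one_ne_zero,
    ProbabilityTheory.gaussianReal_of_var_ne_zero _ one_ne_zero,
    ← withDensity_mul _ (ProbabilityTheory.measurable_gaussianPDF _ _)
      (measurable_gaussianShiftDensity h)]
  congr 1
  ext y
  simp only [Pi.mul_apply, gaussianShiftDensity, ProbabilityTheory.gaussianPDF,
    ProbabilityTheory.gaussianPDFReal]
  rw [← ENNReal.ofReal_mul (by positivity), mul_assoc (√_)⁻¹, ← Real.exp_add]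
  congr 3
  push_cast
  ring

lemma lintegral_gaussianShiftDensity_sq (h : ℝ) :
    ∫⁻ y, gaussianShiftDensity h y ^ 2 ∂(ProbabilityTheory.gaussianReal 0 1)
      = ENNReal.ofReal (Real.exp (h ^ 2)) := by
  have hsq : ∀ y, gaussianShiftDensity h y ^ 2
      = ENNReal.ofReal (Real.exp (-h ^ 2) * Real.exp (2 * h * y)) := by
    intro y
    rw [gaussianShiftDensity, ← ENNReal.ofReal_pow (Real.exp_nonneg _), ← Real.exp_nat_mul,
      ← Real.exp_add]
    congr 2
    push_cast
    ring
  simp_rw [hsq]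
  rw [← ofReal_integral_eq_lintegral_ofReal
    ((ProbabilityTheory.integrable_exp_mul_gaussianReal (2 * h)).const_mul _)
    (.of_forall fun y => by positivity), integral_const_mul]
  have hmgf := congrFun (ProbabilityTheory.mgf_id_gaussianReal (μ := 0) (v := 1)) (2 * h)
  simp only [ProbabilityTheory.mgf, id] at hmgf
  rw [hmgf, ← Real.exp_add]
  congr 2
  push_cast
  ring

/-- Le Cam's two-point bound for a measure and its image under a map whose likelihood ratio has
second moment at most `2`. -/
lemma half_le_measure_add_measure_preimage_compl {Ω : Type*} [MeasurableSpace Ω]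
    (P : Measure Ω) [IsProbabilityMeasure P] {T : Ω → Ω} (hT : Measurable T)
    {L : Ω → ENNReal} (hL : Measurable L) (hmap : P.map T = P.withDensity L)
    (hL2 : ∫⁻ ω, L ω ^ 2 ∂P ≤ 2) {B : Set Ω} (hB : MeasurableSet B) :
    (1 : ℝ) / 2 ≤ (P B).toReal + (P (T ⁻¹' Bᶜ)).toReal := by
  have hL1 : ∫⁻ ω, L ω ∂P = 1 := by
    rw [← setLIntegral_univ, ← withDensity_apply _ .univ, ← hmap, Measure.map_apply hT .univ]
    simp
  have hpt : ∀ ω, L ω ≤ B.indicator 1 ω + Bᶜ.indicator L ω + L ω ^ 2 / 4 := by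
    intro ω
    by_cases hω : ω ∈ B
    · simp only [hω, Set.indicator_of_mem, Pi.one_apply, Set.mem_compl_iff, not_true,
        not_false_eq_true, Set.indicator_of_notMem, add_zero]
      by_cases htop : L ω = ⊤
      · simp [htop, ENNReal.top_div]
      · lift L ω to NNReal using htop with x
        have : x ≤ 1 + x ^ 2 / 4 := by
          rw [← NNReal.coe_le_coe]
          push_cast
          nlinarith [sq_nonneg ((x : ℝ) / 2 - 1)]
        have h4 : ((x ^ 2 / 4 : NNReal) : ENNReal) = (x : ENNReal) ^ 2 / 4 := by
          rw [ENNReal.coe_div (by norm_num)]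
          simp
        rw [← h4]
        exact_mod_cast this
    · simp [hω]
  have key : (1 : ENNReal) ≤ P B + P (T ⁻¹' Bᶜ) + 2 / 4 := by
    calc (1 : ENNReal) = ∫⁻ ω, L ω ∂P := hL1.symm
      _ ≤ ∫⁻ ω, (B.indicator 1 ω + Bᶜ.indicator L ω + L ω ^ 2 / 4) ∂P := lintegral_mono hpt
      _ = P B + P (T ⁻¹' Bᶜ) + (∫⁻ ω, L ω ^ 2 ∂P) / 4 := by
        have h1 : Measurable (B.indicator (1 : Ω → ENNReal)) := measurable_one.indicator hB
        have h2 : Measurable (Bᶜ.indicator L) := hL.indicator hB.compl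
        have h12 : Measurable fun ω => B.indicator (1 : Ω → ENNReal) ω + Bᶜ.indicator L ω :=
          h1.add h2
        rw [lintegral_add_left h12, lintegral_add_left h1, lintegral_indicator_one hB,
          lintegral_indicator hB.compl, ← withDensity_apply _ hB.compl, ← hmap,
          Measure.map_apply hT hB.compl]
        simp_rw [ENNReal.div_eq_inv_mul]
        rw [lintegral_const_mul _ (by fun_prop)]
      _ ≤ _ := by gcongr
  have h := ENNReal.toReal_mono (by finiteness) key
  rw [ENNReal.toReal_add (by finiteness) (by finiteness),
    ENNReal.toReal_add (by finiteness) (by finiteness)] at h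
  norm_num [-Set.preimage_compl] at h
  linarith

/-- Translation of every response noise by `h`. -/
def shiftNoise {U E : Type*} {n : ℕ} (h : ℝ) (ω : U × (Fin n → E × ℝ)) : U × (Fin n → E × ℝ) :=
  (ω.1, fun i => ((ω.2 i).1, (ω.2 i).2 + h))

lemma measurable_shiftNoise {U E : Type*} [MeasurableSpace U] [MeasurableSpace E] {n : ℕ}
    (h : ℝ) : Measurable (shiftNoise (U := U) (E := E) (n := n) h) := by
  unfold shiftNoise
  fun_prop

lemma map_shiftNoise {U E : Type*} [MeasurableSpace U] [MeasurableSpace E] {n : ℕ} (h : ℝ)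
    (PU : Measure U) [IsProbabilityMeasure PU] (PE : Measure E) [IsProbabilityMeasure PE] :
    (PU.prod (Measure.pi fun _ : Fin n =>
        PE.prod (ProbabilityTheory.gaussianReal 0 1))).map (shiftNoise h)
      = (PU.prod (Measure.pi fun _ : Fin n =>
          PE.prod (ProbabilityTheory.gaussianReal 0 1))).withDensity
        (fun ω => ∏ i, gaussianShiftDensity h (ω.2 i).2) := by
  have hd := measurable_gaussianShiftDensity h
  set G := ProbabilityTheory.gaussianReal 0 1 with hG
  have hGmap : G.map (· + h) = G.withDensity (gaussianShiftDensity h) :=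
    gaussianReal_map_add_eq_withDensity h
  have : IsProbabilityMeasure (G.withDensity (gaussianShiftDensity h)) :=
    hGmap ▸ Measure.isProbabilityMeasure_map (by fun_prop)
  have hTm : Measurable (Prod.map (id : E → E) (· + h)) :=
    measurable_id.prodMap (measurable_id.add_const h)
  have hEmap : (PE.prod G).map (Prod.map id (· + h))
      = (PE.prod G).withDensity (fun p => gaussianShiftDensity h p.2) := by
    rw [← Measure.map_prod_map _ _ measurable_id (by fun_prop), Measure.map_id, hGmap,
      prod_withDensity_comp_snd _ _ _ hd]
  have : IsProbabilityMeasure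
      ((PE.prod G).withDensity (fun p => gaussianShiftDensity h p.2)) :=
    hEmap ▸ Measure.isProbabilityMeasure_map (by fun_prop)
  have hpim : Measurable fun (e : Fin n → E × ℝ) i => Prod.map (id : E → E) (· + h) (e i) :=
    measurable_pi_lambda _ fun i => hTm.comp (measurable_pi_apply i)
  have hpimap : (Measure.pi fun _ : Fin n => PE.prod G).map
      (fun e i => Prod.map id (· + h) (e i))
      = (Measure.pi fun _ : Fin n => PE.prod G).withDensity
        (fun e => ∏ i, gaussianShiftDensity h (e i).2) := by
    have : IsProbabilityMeasure ((PE.prod G).map (Prod.map id (· + h))) :=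
      Measure.isProbabilityMeasure_map (by fun_prop)
    rw [Measure.pi_map_pi (fun i => hTm.aemeasurable)]
    simp_rw [hEmap]
    rw [pi_withDensity_prod _ (fun p : E × ℝ => gaussianShiftDensity h p.2) (by fun_prop)]
  have : IsProbabilityMeasure ((Measure.pi fun _ : Fin n => PE.prod G).withDensity
      (fun e => ∏ i, gaussianShiftDensity h (e i).2)) :=
    hpimap ▸ Measure.isProbabilityMeasure_map hpim.aemeasurable
  have hfun : (shiftNoise h : U × (Fin n → E × ℝ) → _)
      = Prod.map id (fun e i => Prod.map id (· + h) (e i)) := rfl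
  rw [hfun, ← Measure.map_prod_map _ _ measurable_id hpim, Measure.map_id, hpimap,
    prod_withDensity_comp_snd _ _ (fun e : Fin n → E × ℝ => ∏ i, gaussianShiftDensity h (e i).2)
      (by fun_prop)]

lemma lintegral_prod_gaussianShiftDensity_sq {U E : Type*} [MeasurableSpace U]
    [MeasurableSpace E] {n : ℕ} (h : ℝ)
    (PU : Measure U) [IsProbabilityMeasure PU] (PE : Measure E) [IsProbabilityMeasure PE] :
    ∫⁻ ω, (∏ i, gaussianShiftDensity h (ω.2 i).2) ^ 2 ∂(PU.prod (Measure.pi fun _ : Fin n =>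
        PE.prod (ProbabilityTheory.gaussianReal 0 1)))
      = ENNReal.ofReal (Real.exp (n * h ^ 2)) := by
  have hd := measurable_gaussianShiftDensity h
  simp_rw [← Finset.prod_pow]
  rw [measurePreserving_snd.lintegral_comp
      (f := fun e : Fin n → E × ℝ => ∏ i, gaussianShiftDensity h (e i).2 ^ 2) (by fun_prop),
    lintegral_pi_prod_eval _ (fun _ (p : E × ℝ) => gaussianShiftDensity h p.2 ^ 2)
      (fun i => by fun_prop)]
  simp_rw [measurePreserving_snd.lintegral_comp (hd.pow_const 2),
    lintegral_gaussianShiftDensity_sq]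
  rw [Finset.prod_const, Finset.card_univ, Fintype.card_fin,
    ← ENNReal.ofReal_pow (Real.exp_nonneg _), ← Real.exp_nat_mul]

lemma hasLocalDim_pi_s17 {X : Type*} [PseudoMetricSpace X] [MeasurableSpace X] {d : ℕ}
    (ν : Measure X) [SigmaFinite ν] (x : Fin d → X)
    (hν : ∀ i, ∀ r : ℝ, 0 < r → r ≤ 1 → ν (closedBall (x i) r) = ENNReal.ofReal r) :
    HasLocalDim (Measure.pi fun _ : Fin d => ν) x (d : ℝ) := by
  have hev : (fun r : ℝ => ((Measure.pi fun _ : Fin d => ν) (closedBall x r)).toReal / r ^ (d : ℝ))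
      =ᶠ[nhdsWithin 0 (Set.Ioi 0)] fun _ => 1 := by
    filter_upwards [Ioc_mem_nhdsGT (zero_lt_one' ℝ)] with r hr
    rw [closedBall_pi _ hr.1.le, Measure.pi_pi, Finset.prod_congr rfl fun i _ => hν i r hr.1 hr.2,
      Finset.prod_const, Finset.card_univ, Fintype.card_fin, ENNReal.toReal_pow,
      ENNReal.toReal_ofReal hr.1.le, Real.rpow_natCast]
    exact div_self (pow_ne_zero _ hr.1.ne')
  rw [HasLocalDim, liminf_congr hev, liminf_const]
  exact one_pos

lemma volume_closedBall_zero_Icc {r : ℝ} (hr1 : r ≤ 1) :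
    (volume : Measure (Set.Icc (0:ℝ) 1)) (closedBall 0 r) = ENNReal.ofReal r := by
  rw [Measure.Subtype.volume_def, Measure.comap_apply _ Subtype.val_injective
    (fun s hs => MeasurableSet.subtype_image measurableSet_Icc hs) _ measurableSet_closedBall]
  have : Set.image Subtype.val (closedBall (0 : Set.Icc (0:ℝ) 1) r) = Set.Icc 0 r := by
    ext y
    simp only [Set.mem_image, mem_closedBall, Subtype.dist_eq, Real.dist_eq, Subtype.exists,
      Set.mem_Icc, Set.Icc.coe_zero, sub_zero]
    constructor
    · rintro ⟨a, ha, h, rfl⟩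
      exact ⟨ha.1, (abs_le.1 h).2⟩
    · rintro ⟨h0, h⟩
      exact ⟨y, ⟨h0, h.trans hr1⟩, abs_le.2 ⟨by linarith, h⟩, rfl⟩
  rw [this, Real.volume_Icc, sub_zero]

/-- The uniform distribution on `[-1,1]`. -/
def uniformSymm : Measure ℝ := (2 : ENNReal)⁻¹ • volume.restrict (Set.Icc (-1) 1)

instance : IsProbabilityMeasure uniformSymm := by
  constructor
  simp only [uniformSymm, Measure.smul_apply, Measure.restrict_apply_univ, Real.volume_Icc,
    smul_eq_mul]
  norm_num
  exact ENNReal.inv_mul_cancel (by simp) (by simp)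

lemma uniformSymm_closedBall_zero {r : ℝ} (hr1 : r ≤ 1) :
    uniformSymm (closedBall 0 r) = ENNReal.ofReal r := by
  have hsub : closedBall (0:ℝ) r ⊆ Set.Icc (-1) 1 := by
    rw [Real.closedBall_eq_Icc]
    exact Set.Icc_subset_Icc (by linarith) (by linarith)
  rw [uniformSymm, Measure.smul_apply, Measure.restrict_apply measurableSet_closedBall,
    Set.inter_eq_left.2 hsub, Real.volume_closedBall, ENNReal.ofReal_mul (by norm_num),
    smul_eq_mul, ← mul_assoc, ENNReal.ofReal_ofNat, ENNReal.inv_mul_cancel (by simp) (by simp),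
    one_mul]

lemma integral_uniformSymm : ∫ x, x ∂uniformSymm = 0 := by
  rw [uniformSymm, integral_smul_measure, integral_Icc_eq_integral_Ioc,
    ← intervalIntegral.integral_of_le (by norm_num), integral_id]
  norm_num

lemma mgf_uniformSymm_le (t : ℝ) : ∫ x, Real.exp (x * t) ∂uniformSymm ≤ Real.exp (t ^ 2 / 2) := by
  have hmem : ∀ᵐ x ∂uniformSymm, id x ∈ Set.Icc (-1:ℝ) 1 :=
    Measure.ae_smul_measure (ae_restrict_mem measurableSet_Icc) _
  have h := (ProbabilityTheory.hasSubgaussianMGF_of_mem_Icc_of_integral_eq_zero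
    aemeasurable_id hmem integral_uniformSymm).mgf_le t
  simp only [ProbabilityTheory.mgf, id] at h
  norm_num at h
  simpa only [mul_comm] using h

lemma subGaussianVec_pi_uniformSymm (d : ℕ) :
    SubGaussianVec (Measure.pi fun _ : Fin d => uniformSymm) := by
  intro t
  simp_rw [Real.exp_sum]
  rw [integral_fintype_prod_eq_prod (fun j x => Real.exp (x * t j)), Finset.sum_div, Real.exp_sum]
  exact Finset.prod_le_prod (fun j _ => integral_nonneg fun x => (Real.exp_pos _).le)
    fun j _ => mgf_uniformSymm_le (t j)

lemma subGaussianReal_gaussianReal : SubGaussianReal (ProbabilityTheory.gaussianReal 0 1) := by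
  intro t
  have hmgf := congrFun (ProbabilityTheory.mgf_id_gaussianReal (μ := 0) (v := 1)) t
  simp only [ProbabilityTheory.mgf, id] at hmgf
  simp_rw [mul_comm _ t]
  rw [hmgf]
  simp

/-- Two constant regression functions cannot be told apart: no active estimator has failure
probability below `1/4` at level `σY / (4 * √n)` for both. -/
lemma exists_const_active_lower_bound {C E U : Type*} [MeasurableSpace C] [MeasurableSpace E]
    [MeasurableSpace U] {n : ℕ} (hn : 0 < n) {σY : ℝ} (ξ : E → E) (hξ : Measurable ξ) (PU : Measure U) [IsProbabilityMeasure PU]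
    (PE : Measure E) [IsProbabilityMeasure PE]
    (ζ : (i : Fin n) → (Fin (i : ℕ) → C × E × ℝ) → U → C)
    (est : (Fin n → C × E × ℝ) → U → ℝ)
    (hζ : ∀ i : Fin n, Measurable
      (fun p : (Fin (i : ℕ) → C × E × ℝ) × U => ζ i p.1 p.2))
    (hest : Measurable (fun p : (Fin n → C × E × ℝ) × U => est p.1 p.2)) :
    ∃ c : ℝ, ∀ (Z : Fin n → U × (Fin n → E × ℝ) → C)
      (X : Fin n → U × (Fin n → E × ℝ) → E) (Y : Fin n → U × (Fin n → E × ℝ) → ℝ),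
      (∀ i ω, Z i ω = ζ i (fun j =>
          (Z ⟨(j : ℕ), j.2.trans i.2⟩ ω,
           X ⟨(j : ℕ), j.2.trans i.2⟩ ω,
           Y ⟨(j : ℕ), j.2.trans i.2⟩ ω)) ω.1) →
      (∀ i ω, X i ω = ξ (ω.2 i).1) →
      (∀ i ω, Y i ω = c + σY * (ω.2 i).2) →
      (1 : ℝ) / 4 ≤
        ((PU.prod (Measure.pi fun _ : Fin n => PE.prod (ProbabilityTheory.gaussianReal 0 1)))
          {ω | σY / (4 * Real.sqrt n) ≤
            |est (fun i => (Z i ω, X i ω, Y i ω)) ω.1 - c|}).toReal := by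
  set P := PU.prod (Measure.pi fun _ : Fin n => PE.prod (ProbabilityTheory.gaussianReal 0 1))
    with hP
  by_contra! hcon
  have hn' : (0 : ℝ) < Real.sqrt n := Real.sqrt_pos.2 (by exact_mod_cast hn)
  set δ := σY / (4 * Real.sqrt n) with hδ
  set h := 1 / (2 * Real.sqrt n) with hh
  have hδh : σY * h = 2 * δ := by
    rw [hδ, hh]
    field_simp
    norm_num
  obtain ⟨Z, X, Y, hZ, hX, hY, hlt⟩ := hcon 0
  obtain ⟨Z', X', Y', hZ', hX', hY', hlt'⟩ := hcon (2 * δ)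
  have hXm : ∀ i, Measurable (X i) := fun i => by
    rw [funext (hX i)]
    fun_prop
  have hYm : ∀ i, Measurable (Y i) := fun i => by
    rw [funext (hY i)]
    fun_prop
  have hZm : ∀ k (hk : k < n), Measurable (Z ⟨k, hk⟩) := by
    intro k
    induction k using Nat.strong_induction_on with
    | _ k ih =>
      intro hk
      rw [funext (hZ ⟨k, hk⟩)]
      refine (hζ ⟨k, hk⟩).comp (Measurable.prodMk (measurable_pi_lambda _ fun j => ?_)
        measurable_fst)
      exact (ih j j.2 _).prodMk ((hXm _).prodMk (hYm _))
  have hXs : ∀ i ω, X' i ω = X i (shiftNoise h ω) := fun i ω => by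
    rw [hX', hX, shiftNoise]
  have hYs : ∀ i ω, Y' i ω = Y i (shiftNoise h ω) := fun i ω => by
    rw [hY', hY, shiftNoise, mul_add, hδh]
    ring
  have hZs : ∀ k (hk : k < n) ω, Z' ⟨k, hk⟩ ω = Z ⟨k, hk⟩ (shiftNoise h ω) := by
    intro k
    induction k using Nat.strong_induction_on with
    | _ k ih =>
      intro hk ω
      rw [hZ', hZ]
      congr 1
      funext j
      rw [hXs, hYs, ih j j.2]
  set B : Set (U × (Fin n → E × ℝ)) :=
    {ω | δ ≤ |est (fun i => (Z i ω, X i ω, Y i ω)) ω.1 - 0|} with hB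
  have hBm : MeasurableSet B := by
    have : Measurable fun ω => est (fun i => (Z i ω, X i ω, Y i ω)) ω.1 :=
      hest.comp (Measurable.prodMk (measurable_pi_lambda _ fun i =>
        (hZm i i.2).prodMk ((hXm i).prodMk (hYm i))) measurable_fst)
    exact measurableSet_le measurable_const (by fun_prop)
  have hsub : shiftNoise h ⁻¹' Bᶜ ⊆
      {ω | δ ≤ |est (fun i => (Z' i ω, X' i ω, Y' i ω)) ω.1 - 2 * δ|} := by
    intro ω hω
    have hdata : (fun i => (Z' i ω, X' i ω, Y' i ω)) = fun i =>
        (Z i (shiftNoise h ω), X i (shiftNoise h ω), Y i (shiftNoise h ω)) := by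
      funext i
      rw [hXs, hYs, hZs i i.2]
    simp only [hB, Set.mem_preimage, Set.mem_compl_iff, Set.mem_ofPred_eq, not_le, sub_zero] at hω
    rw [Set.mem_ofPred_eq, hdata]
    have h1 := (abs_lt.1 hω).2
    rw [abs_sub_comm]
    refine le_trans ?_ (le_abs_self _)
    change est _ ω.1 < δ at h1
    linarith
  have hnh : (n : ℝ) * h ^ 2 = 1 / 4 := by
    rw [hh, div_pow, mul_pow, Real.sq_sqrt (Nat.cast_nonneg n)]
    field_simp
    norm_num
  have hexp : Real.exp (1 / 4) ≤ 2 := by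
    rw [← Real.le_log_iff_exp_le two_pos]
    linarith [Real.log_two_gt_d9]
  have hsum := half_le_measure_add_measure_preimage_compl P (measurable_shiftNoise h)
    (L := fun ω => ∏ i, gaussianShiftDensity h (ω.2 i).2)
    (by have := measurable_gaussianShiftDensity h; fun_prop) (map_shiftNoise h PU PE)
    (by
      rw [lintegral_prod_gaussianShiftDensity_sq, hnh]
      simpa using ENNReal.ofReal_le_ofReal hexp) hBm
  have hle := ENNReal.toReal_mono (measure_ne_top P _) (measure_mono hsub)
  linarith

/-- **Proposition 6 (Active minimax lower bound, small covariate noise, large response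
noise):** failure probability at least `1/4` at error level `σ_Y/(4√n)`. -/
theorem active_lower_bound_no_covariate_noise
    (sg sf Lg Lf : ℝ) (dX dZ : ℕ)
    (hsg : sg ∈ Set.Ioc (0:ℝ) 1) (hsf : sf ∈ Set.Ioc (0:ℝ) 1)
    (hLg : 0 < Lg) (hLf : 0 < Lf) (hdX : 0 < dX) (hdZ : 0 < dZ) :
      ∀ (n : ℕ), 0 < n →
      ∀ (σX σY : ℝ), 0 ≤ σX → 0 ≤ σY →
      ∀ x0 : Fin dX → ℝ,
      ∀ (U : Type) [MeasurableSpace U] (PU : Measure U) [IsProbabilityMeasure PU]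
        (ζ : (i : Fin n) → (Fin (i : ℕ) → Cube dZ × (Fin dX → ℝ) × ℝ) → U → Cube dZ)
        (est : (Fin n → Cube dZ × (Fin dX → ℝ) × ℝ) → U → ℝ),
        (∀ i : Fin n, Measurable
          (fun p : (Fin (i : ℕ) → Cube dZ × (Fin dX → ℝ) × ℝ) × U => ζ i p.1 p.2)) →
        Measurable (fun p : (Fin n → Cube dZ × (Fin dX → ℝ) × ℝ) × U => est p.1 p.2) →
      ∃ (g : Cube dZ → Fin dX → ℝ) (f : (Fin dX → ℝ) → ℝ)
        (PZ : Measure (Cube dZ)) (PeX : Measure (Fin dX → ℝ)) (PeY : Measure ℝ),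
        IsProbabilityMeasure PZ ∧ IsProbabilityMeasure PeX ∧ IsProbabilityMeasure PeY ∧
        GlobHolderBall sg Lg g ∧ GlobHolderBall sf Lf f ∧
        (∃ z0 : Cube dZ, g z0 = x0 ∧ HasLocalDim PZ z0 (dZ : ℝ)) ∧
        HasLocalDim PeX 0 (dX : ℝ) ∧
        SubGaussianVec PeX ∧ SubGaussianReal PeY ∧
        (∀ j, ∫ x, x j ∂PeX = 0) ∧ (∫ y, y ∂PeY = 0) ∧
        ∀ (Z : Fin n → U × (Fin n → (Fin dX → ℝ) × ℝ) → Cube dZ)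
          (X : Fin n → U × (Fin n → (Fin dX → ℝ) × ℝ) → (Fin dX → ℝ))
          (Y : Fin n → U × (Fin n → (Fin dX → ℝ) × ℝ) → ℝ),
          (∀ i ω, Z i ω = ζ i (fun j =>
              (Z ⟨(j : ℕ), j.2.trans i.2⟩ ω,
               X ⟨(j : ℕ), j.2.trans i.2⟩ ω,
               Y ⟨(j : ℕ), j.2.trans i.2⟩ ω)) ω.1) →
          (∀ i ω, X i ω = g (Z i ω) + σX • (ω.2 i).1) →
          (∀ i ω, Y i ω = f (X i ω) + σY * (ω.2 i).2) →
          (1 : ℝ) / 4 ≤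
            ((PU.prod (Measure.pi fun _ : Fin n => PeX.prod PeY))
              {ω | σY / (4 * Real.sqrt n) ≤
                |est (fun i => (Z i ω, X i ω, Y i ω)) ω.1 - f x0|}).toReal := by
  intro n hn σX σY _ _ x0 U _ PU _ ζ est hζ hest
  obtain ⟨c, hc⟩ := exists_const_active_lower_bound hn (fun e => x0 + σX • e) (by fun_prop)
    PU (Measure.pi fun _ : Fin dX => uniformSymm) ζ est hζ hest
  refine ⟨fun _ => x0, fun _ => c, Measure.pi fun _ => volume,
    Measure.pi fun _ => uniformSymm, ProbabilityTheory.gaussianReal 0 1,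
    inferInstance, inferInstance, inferInstance, fun z z' => ?_, fun x x' => ?_,
    ⟨0, rfl, hasLocalDim_pi_s17 _ _ fun _ _ _ hr1 => volume_closedBall_zero_Icc hr1⟩,
    hasLocalDim_pi_s17 _ _ fun _ _ _ hr1 => uniformSymm_closedBall_zero hr1,
    subGaussianVec_pi_uniformSymm dX, subGaussianReal_gaussianReal, fun j => ?_,
    ProbabilityTheory.integral_id_gaussianReal, hc⟩
  · rw [dist_self]
    positivity
  · rw [dist_self]
    positivity
  · rw [← integral_uniformSymm]
    exact integral_comp_eval (μ := fun _ : Fin dX => uniformSymm) (i := j) (f := id)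
      aestronglyMeasurable_id

end
end
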